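/- Let H be an m×n real matrix with full column rank and let k be a row index whose row of H is nonzero. Then the minimum of |support(H·c)| over all c ∈ ℝⁿ with (H·c)_k ≠ 0 is equal to the minimum cardinality of an (algebraic) observability set containing k; in particular both minima are attained over nonempty families. (Algebraic form of Theorem 5 / Problem 1: the sparsest stealthy attack containing measurement k corresponds to the lowest-cardinality critical/observability set containing k) -/

import Mathlib

/-- The submatrix of `H` obtained by deleting the rows indexed by `S`. -/
def delRows {m n : ℕ} (H : Matrix (Fin m) (Fin n) ℝ) (S : Set (Fin m)) :
    Matrix {i : Fin m // i ∉ S} (Fin n) ℝ :=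
  Matrix.of fun i j => H i.1 j

/-- `S` is an (algebraic) observability set: `H^(−S)` has nontrivial kernel, while adding
back any single row `k ∈ S` yields a matrix with trivial kernel. -/
def IsObsSet {m n : ℕ} (H : Matrix (Fin m) (Fin n) ℝ) (S : Set (Fin m)) : Prop :=
  (∃ c : Fin n → ℝ, c ≠ 0 ∧ (delRows H S).mulVec c = 0) ∧
  (∀ k ∈ S, ∀ c : Fin n → ℝ, (delRows H (S \ {k})).mulVec c = 0 → c = 0)

/-- A matrix of full column rank has trivial kernel. -/
theorem Matrix.eq_zero_of_rank_eq_of_mulVec_eq_zero {m n : ℕ} (H : Matrix (Fin m) (Fin n) ℝ)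
    (hH : H.rank = n) {c : Fin n → ℝ} (hc : H.mulVec c = 0) : c = 0 := by
  have h := H.mulVecLin.finrank_range_add_finrank_ker
  rw [Module.finrank_fin_fun] at h
  have hker : Module.finrank ℝ (LinearMap.ker H.mulVecLin) = 0 := by
    unfold Matrix.rank at hH
    omega
  have hmem : c ∈ LinearMap.ker H.mulVecLin := by simpa using hc
  rw [Submodule.finrank_eq_zero.mp hker] at hmem
  simpa using hmem

theorem delRows_mulVec_eq_zero_iff {m n : ℕ} (H : Matrix (Fin m) (Fin n) ℝ) (S : Set (Fin m))
    (c : Fin n → ℝ) :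
    (delRows H S).mulVec c = 0 ↔ Function.support (H.mulVec c) ⊆ S := by
  rw [Function.support_subset_iff', funext_iff]
  exact Subtype.forall

/-- An observability set contains the support of a stealthy attack on any of its members. -/
theorem IsObsSet.exists_support_subset {m n : ℕ} {H : Matrix (Fin m) (Fin n) ℝ}
    {S : Set (Fin m)} (hS : IsObsSet H S) {k : Fin m} (hk : k ∈ S) :
    ∃ c : Fin n → ℝ, H.mulVec c k ≠ 0 ∧ Function.support (H.mulVec c) ⊆ S := by
  obtain ⟨⟨c, hc0, hc⟩, hmin⟩ := hS
  rw [delRows_mulVec_eq_zero_iff] at hc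
  refine ⟨c, fun hck => hc0 (hmin k hk c ?_), hc⟩
  rw [delRows_mulVec_eq_zero_iff]
  exact Set.subset_sdiff_singleton hc (by simpa using hck)

/-- The support of a sparsest stealthy attack on a given measurement is an observability set. -/
theorem isObsSet_support_of_minimal {m n : ℕ} {H : Matrix (Fin m) (Fin n) ℝ}
    (hH : H.rank = n) {k : Fin m} {c : Fin n → ℝ} (hck : H.mulVec c k ≠ 0)
    (hmin : ∀ d : Fin n → ℝ, H.mulVec d k ≠ 0 →
      (Function.support (H.mulVec c)).ncard ≤ (Function.support (H.mulVec d)).ncard) :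
    IsObsSet H (Function.support (H.mulVec c)) := by
  have no_smaller : ∀ d : Fin n → ℝ, ∀ j ∈ Function.support (H.mulVec c), H.mulVec d k ≠ 0 →
      ¬ Function.support (H.mulVec d) ⊆ Function.support (H.mulVec c) \ {j} := by
    intro d j hj hdk hsub
    have h₁ := Set.ncard_le_ncard hsub (Set.toFinite _)
    have h₂ := Set.ncard_sdiff_singleton_lt_of_mem hj (Set.toFinite _)
    have h₃ := hmin d hdk
    omega
  refine ⟨⟨c, ?_, (delRows_mulVec_eq_zero_iff H _ c).mpr subset_rfl⟩, fun j hj d hd => ?_⟩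
  · rintro rfl
    simp at hck
  · rw [delRows_mulVec_eq_zero_iff] at hd
    by_contra hd0
    have hdk : H.mulVec d k = 0 := by
      by_contra hdk
      exact no_smaller d j hj hdk hd
    obtain ⟨i, hi⟩ : ∃ i, H.mulVec d i ≠ 0 := by
      by_contra! h
      exact hd0 (H.eq_zero_of_rank_eq_of_mulVec_eq_zero hH (funext h))
    have hval : ∀ l, H.mulVec (c - (H.mulVec c i / H.mulVec d i) • d) l =
        H.mulVec c l - H.mulVec c i / H.mulVec d i * H.mulVec d l := fun l => by
      simp [Matrix.mulVec_sub, Matrix.mulVec_smul]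
    refine no_smaller (c - (H.mulVec c i / H.mulVec d i) • d) i (hd hi).1 ?_ ?_
    · rwa [hval, hdk, mul_zero, sub_zero]
    · refine Set.subset_sdiff_singleton (fun l hl => ?_) ?_
      · by_contra hlc
        have hld : H.mulVec d l = 0 := by
          by_contra hld
          exact hlc (hd hld).1
        rw [Function.mem_support, hval, hld, Function.notMem_support.mp hlc] at hl
        simp at hl
      · rw [Function.notMem_support, hval, div_mul_cancel₀ _ hi, sub_self]

/-- Algebraic form of Theorem 5 / Problem 1: for `H` of full column rank and a row index
`k` whose row is nonzero, the minimum cardinality of the support of a stealthy attack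
`H·c` with `(H·c)_k ≠ 0` equals the minimum cardinality of an observability set containing
`k`; both minima are attained over nonempty families. -/
theorem sparsest_stealthy_attack_containing_k
    {m n : ℕ} (H : Matrix (Fin m) (Fin n) ℝ) (hH : H.rank = n)
    (k : Fin m) (hk : (fun j => H k j) ≠ 0) :
    {s : ℕ | ∃ c : Fin n → ℝ, H.mulVec c k ≠ 0 ∧
        s = (Function.support (H.mulVec c)).ncard}.Nonempty ∧
    {s : ℕ | ∃ S : Set (Fin m), IsObsSet H S ∧ k ∈ S ∧ s = S.ncard}.Nonempty ∧
    sInf {s : ℕ | ∃ c : Fin n → ℝ, H.mulVec c k ≠ 0 ∧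
        s = (Function.support (H.mulVec c)).ncard} =
      sInf {s : ℕ | ∃ S : Set (Fin m), IsObsSet H S ∧ k ∈ S ∧ s = S.ncard} := by
  set A := {s : ℕ | ∃ c : Fin n → ℝ, H.mulVec c k ≠ 0 ∧
    s = (Function.support (H.mulVec c)).ncard}
  set B := {s : ℕ | ∃ S : Set (Fin m), IsObsSet H S ∧ k ∈ S ∧ s = S.ncard}
  have hAne : A.Nonempty :=
    ⟨_, fun j => H k j, fun h => hk (dotProduct_self_eq_zero.mp h), rfl⟩
  obtain ⟨c, hck, hc⟩ := Nat.sInf_mem hAne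
  have hmem : sInf A ∈ B :=
    ⟨_, isObsSet_support_of_minimal hH hck
      (fun d hd => hc ▸ Nat.sInf_le ⟨d, hd, rfl⟩), hck, hc⟩
  refine ⟨hAne, ⟨_, hmem⟩, le_antisymm ?_ (Nat.sInf_le hmem)⟩
  obtain ⟨S, hS, hkS, hcard⟩ := Nat.sInf_mem (Set.nonempty_of_mem hmem)
  obtain ⟨d, hdk, hd⟩ := hS.exists_support_subset hkS
  rw [hcard]
  have hdA : (Function.support (H.mulVec d)).ncard ∈ A := ⟨d, hdk, rfl⟩
  exact (Nat.sInf_le hdA).trans (Set.ncard_le_ncard hd (Set.toFinite _))
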